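/- arXiv:1903.00209 — 8 statements merged into one kernel-verified Lean document; each statement's English description precedes it below -/
import Mathlib

section
/- Let n ≥ 2, p ≥ 1, let H_1,…,H_p be real symmetric n×n matrices, and let e_1,…,e_n be an orthonormal basis of ℝⁿ with h^α_{ik} = ⟨H_α e_i, e_k⟩. Then Σ_α Σ_{k=2}^n (h^α_{1k})² ≤ (1/2)(S − nH²). -/
open Matrix BigOperators

noncomputable section

/-- Squared mean curvature `H² = Σ_α (tr H_α / n)²`. -/
def meanCurvSq (n p : ℕ) (Hm : Fin p → Matrix (Fin n) (Fin n) ℝ) : ℝ :=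
  ∑ α, ((Hm α).trace / n) ^ 2

/-- `S = Σ_α ‖H_α‖²` (squared Frobenius norm of the second fundamental form). -/
def sqNormSff (n p : ℕ) (Hm : Fin p → Matrix (Fin n) (Fin n) ℝ) : ℝ :=
  ∑ α, ∑ i, ∑ j, (Hm α i j) ^ 2

/-- Scalar curvature `R = n(n−1)c + n²H² − S`. -/
def scalarCurv (n p : ℕ) (Hm : Fin p → Matrix (Fin n) (Fin n) ℝ) (c : ℝ) : ℝ :=
  n * (n - 1) * c + n ^ 2 * meanCurvSq n p Hm - sqNormSff n p Hm

/-- Ricci curvature of a unit vector `u`, via the Gauss equation: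
`Ric(u) = (n−1)c + Σ_α (tr(H_α)⟨H_α u,u⟩ − ‖H_α u‖²)`. -/
def ricci (n p : ℕ) (Hm : Fin p → Matrix (Fin n) (Fin n) ℝ) (c : ℝ) (u : Fin n → ℝ) : ℝ :=
  (n - 1) * c + ∑ α, ((Hm α).trace * ((Hm α).mulVec u ⬝ᵥ u)
    - (Hm α).mulVec u ⬝ᵥ (Hm α).mulVec u)

/-- Second fundamental form `h(u,v) = (⟨H_1 u,v⟩,…,⟨H_p u,v⟩) ∈ ℝ^p`. -/
def sff (n p : ℕ) (Hm : Fin p → Matrix (Fin n) (Fin n) ℝ) (u v : Fin n → ℝ) : Fin p → ℝ :=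
  fun α => (Hm α).mulVec u ⬝ᵥ v

/-- Euclidean inner product `⟨h(u,v), h(w,z)⟩` in `ℝ^p`. -/
def sffInner (n p : ℕ) (Hm : Fin p → Matrix (Fin n) (Fin n) ℝ) (u v w z : Fin n → ℝ) : ℝ :=
  ∑ α, sff n p Hm u v α * sff n p Hm w z α

/-- The squared Frobenius norm of a square matrix as a trace. -/
theorem sum_sum_sq_eq_trace_mul_transpose {ι : Type*} [Fintype ι] (A : Matrix ι ι ℝ) :
    ∑ i, ∑ j, A i j ^ 2 = (A * Aᵀ).trace := by
  simp [Matrix.trace, Matrix.mul_apply, sq]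

/-- The squared Frobenius norm of a square matrix is invariant under orthogonal conjugation. -/
theorem sum_sum_sq_conj {ι : Type*} [Fintype ι] [DecidableEq ι] (P A : Matrix ι ι ℝ)
    (hP : Pᵀ * P = 1) :
    ∑ i, ∑ j, (P * A * Pᵀ) i j ^ 2 = ∑ i, ∑ j, A i j ^ 2 := by
  rw [sum_sum_sq_eq_trace_mul_transpose, sum_sum_sq_eq_trace_mul_transpose]
  have h : P * A * Pᵀ * (P * A * Pᵀ)ᵀ = P * (A * Aᵀ) * Pᵀ := by
    calc P * A * Pᵀ * (P * A * Pᵀ)ᵀ = P * A * (Pᵀ * P) * Aᵀ * Pᵀ := by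
          simp only [Matrix.transpose_mul, Matrix.transpose_transpose, Matrix.mul_assoc]
      _ = P * (A * Aᵀ) * Pᵀ := by
          rw [hP, Matrix.mul_one, Matrix.mul_assoc P A]
  rw [h, Matrix.trace_mul_cycle, hP, Matrix.one_mul]

/-- The diagonal and the off-diagonal part of a row and of the corresponding column of a symmetric
matrix contribute separately to its squared Frobenius norm. -/
theorem sum_diag_sq_add_two_mul_sum_col_sq_le {ι : Type*} [Fintype ι] [DecidableEq ι]
    (B : Matrix ι ι ℝ) (hB : B.IsSymm) (a : ι) :
    ∑ i, B i i ^ 2 + 2 * ∑ k with k ≠ a, B k a ^ 2 ≤ ∑ i, ∑ j, B i j ^ 2 := by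
  have hdiag : ∑ i, B i i ^ 2 = ∑ i, ∑ j, if i = j then B i j ^ 2 else 0 := by simp
  have hcol : ∑ k with k ≠ a, B k a ^ 2
      = ∑ i, ∑ j, if j = a then (if i ≠ a then B i j ^ 2 else 0) else 0 := by
    simp [Finset.sum_filter]
  have hrow : ∑ k with k ≠ a, B k a ^ 2
      = ∑ i, ∑ j, if i = a then (if j ≠ a then B i j ^ 2 else 0) else 0 := by
    rw [hcol, Finset.sum_comm]
    simp only [hB.apply]
  rw [two_mul, hdiag]
  nth_rewrite 1 [hcol]
  rw [hrow]
  simp only [← Finset.sum_add_distrib]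
  refine Finset.sum_le_sum fun i _ => Finset.sum_le_sum fun j _ => ?_
  have := sq_nonneg (B i j)
  split_ifs <;> simp_all

/-- For a symmetric matrix, twice the off-diagonal part of a column is bounded by the squared
Frobenius norm of the traceless part. -/
theorem two_mul_sum_col_sq_le {ι : Type*} [Fintype ι] [DecidableEq ι]
    (B : Matrix ι ι ℝ) (hB : B.IsSymm) (a : ι) :
    2 * ∑ k with k ≠ a, B k a ^ 2
      ≤ ∑ i, ∑ j, B i j ^ 2 - Fintype.card ι * (B.trace / Fintype.card ι) ^ 2 := by
  have hcard : (0 : ℝ) < Fintype.card ι := by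
    exact_mod_cast Fintype.card_pos_iff.mpr ⟨a⟩
  have htr : Fintype.card ι * (B.trace / Fintype.card ι) ^ 2 ≤ ∑ i, B i i ^ 2 := by
    have h : B.trace ^ 2 ≤ Fintype.card ι * ∑ i, B i i ^ 2 :=
      sq_sum_le_card_mul_sum_sq (s := Finset.univ) (f := fun i => B i i)
    rw [show Fintype.card ι * (B.trace / Fintype.card ι) ^ 2 = B.trace ^ 2 / Fintype.card ι by
      field_simp, div_le_iff₀ hcard]
    linarith
  linarith [sum_diag_sq_add_two_mul_sum_col_sq_le B hB a]

theorem stmt_3 (n p : ℕ) (hn : 2 ≤ n) (hp : 1 ≤ p)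
    (Hm : Fin p → Matrix (Fin n) (Fin n) ℝ) (hsym : ∀ α, (Hm α).IsSymm)
    (e : Fin n → Fin n → ℝ)
    (he : ∀ i j, e i ⬝ᵥ e j = if i = j then (1 : ℝ) else 0) :
    ∑ α, ∑ k ∈ Finset.univ.filter (fun k : Fin n => 0 < (k : ℕ)),
        ((Hm α).mulVec (e ⟨0, by omega⟩) ⬝ᵥ e k) ^ 2
      ≤ (sqNormSff n p Hm - (n : ℝ) * meanCurvSq n p Hm) / 2 := by
  set z : Fin n := ⟨0, by omega⟩ with hz
  set P : Matrix (Fin n) (Fin n) ℝ := Matrix.of e with hPdef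
  have hP : Pᵀ * P = 1 := by
    refine mul_eq_one_comm.mp ?_
    ext i j
    rw [Matrix.one_apply, ← he i j]
    rfl
  have hfilter : (Finset.univ.filter fun k : Fin n => 0 < (k : ℕ))
      = Finset.univ.filter fun k => k ≠ z := by
    ext k
    simp [hz, Fin.ext_iff, Nat.pos_iff_ne_zero]
  rw [le_div_iff₀ two_pos, mul_comm, hfilter, sqNormSff, meanCurvSq, Finset.mul_sum,
    Finset.mul_sum, ← Finset.sum_sub_distrib]
  refine Finset.sum_le_sum fun α _ => ?_
  have hentry (k : Fin n) : (Hm α).mulVec (e z) ⬝ᵥ e k = (P * Hm α * Pᵀ) k z := by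
    rw [dotProduct_comm, Matrix.mul_assoc]
    rfl
  have hsymm : (P * Hm α * Pᵀ).IsSymm := by
    simp only [Matrix.IsSymm, Matrix.transpose_mul, Matrix.transpose_transpose, (hsym α).eq,
      Matrix.mul_assoc]
  have htrace : (P * Hm α * Pᵀ).trace = (Hm α).trace := by
    rw [Matrix.trace_mul_cycle, hP, Matrix.one_mul]
  simpa only [hentry, sum_sum_sq_conj P (Hm α) hP, htrace, Fintype.card_fin] using
    two_mul_sum_col_sq_le (P * Hm α * Pᵀ) hsymm z
end
end

section
/- Let n ≥ 2, p ≥ 1, let H_1,…,H_p be real symmetric n×n matrices and c a real number. For every orthonormal basis e_1,…,e_n of ℝⁿ, Σ_{k=2}^n [2‖h(e_1,e_k)‖² − ⟨h(e_1,e_1), h(e_k,e_k)⟩] ≤ (n(n−1)/2)(c+H²) − R/2 − Ric(e_1) + (n−1)c. -/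
open Matrix BigOperators

noncomputable section

/-- The squared Frobenius norm of a symmetric matrix dominates its trace part plus twice the
off-diagonal part of any of its rows. -/
lemma trace_sq_div_add_row_le {ι : Type*} [Fintype ι] [DecidableEq ι] {B : Matrix ι ι ℝ}
    (hB : B.IsSymm) (z : ι) :
    B.trace ^ 2 / Fintype.card ι + 2 * ∑ k ∈ Finset.univ.erase z, B z k ^ 2
      ≤ ∑ i, ∑ j, B i j ^ 2 := by
  have hdiag : B.trace ^ 2 / Fintype.card ι ≤ ∑ i, B i i ^ 2 := by
    refine div_le_of_le_mul₀ (Nat.cast_nonneg _) (by positivity) ?_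
    rw [mul_comm]
    exact sq_sum_le_card_mul_sum_sq
  have hz : ∑ j, B z j ^ 2 = B z z ^ 2 + ∑ k ∈ Finset.univ.erase z, B z k ^ 2 :=
    (Finset.add_sum_erase _ _ (Finset.mem_univ z)).symm
  have hrow : ∀ i ∈ Finset.univ.erase z, B i i ^ 2 + B z i ^ 2 ≤ ∑ j, B i j ^ 2 := by
    intro i hi
    rw [← hB.apply z i, ← Finset.sum_pair (f := fun j => B i j ^ 2) (Finset.ne_of_mem_erase hi)]
    exact Finset.sum_le_sum_of_subset_of_nonneg (Finset.subset_univ _)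
      fun j _ _ => sq_nonneg (B i j)
  have hrows := Finset.sum_le_sum hrow
  rw [Finset.sum_add_distrib] at hrows
  rw [← Finset.add_sum_erase _ (fun i => B i i ^ 2) (Finset.mem_univ z)] at hdiag
  rw [← Finset.add_sum_erase _ (fun i => ∑ j, B i j ^ 2) (Finset.mem_univ z), hz]
  linarith

lemma trace_mul_transpose_self {ι : Type*} [Fintype ι] (A : Matrix ι ι ℝ) :
    (A * Aᵀ).trace = ∑ i, ∑ j, A i j ^ 2 := by
  simp [Matrix.trace, Matrix.mul_apply, sq]

/-- The inequality for a single symmetric matrix `A` and an orthonormal basis `e`. -/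
lemma sum_sub_le_of_orthonormal {ι : Type*} [Fintype ι] [DecidableEq ι] {A : Matrix ι ι ℝ}
    (hA : A.IsSymm) {e : ι → ι → ℝ} (he : ∀ i j, e i ⬝ᵥ e j = if i = j then (1 : ℝ) else 0)
    (z : ι) :
    ∑ k ∈ Finset.univ.erase z,
        (2 * ((A *ᵥ e z ⬝ᵥ e k) * (A *ᵥ e z ⬝ᵥ e k)) - (A *ᵥ e z ⬝ᵥ e z) * (A *ᵥ e k ⬝ᵥ e k))
      ≤ (∑ i, ∑ j, A i j ^ 2) / 2 - A.trace ^ 2 / Fintype.card ι / 2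
        - (A.trace * (A *ᵥ e z ⬝ᵥ e z) - A *ᵥ e z ⬝ᵥ A *ᵥ e z) := by
  set U : Matrix ι ι ℝ := Matrix.of e
  have hU : U * Uᵀ = 1 := by
    ext i j
    rw [Matrix.one_apply, ← he i j]
    rfl
  have hU' : Uᵀ * U = 1 := mul_eq_one_comm.mp hU
  set B : Matrix ι ι ℝ := U * A * Uᵀ with hBdef
  have hB : B.IsSymm := by
    simp [Matrix.IsSymm, hBdef, Matrix.transpose_mul, hA.eq, Matrix.mul_assoc]
  have hBe : ∀ i j, A *ᵥ e i ⬝ᵥ e j = B i j := by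
    intro i j
    rw [← hB.apply i j, hBdef, Matrix.mul_assoc, dotProduct_comm]
    rfl
  have htr : B.trace = A.trace := by
    rw [hBdef, Matrix.trace_mul_comm, ← Matrix.mul_assoc, hU', Matrix.one_mul]
  have hBB : B * Bᵀ = U * (A * Aᵀ) * Uᵀ := by
    calc B * Bᵀ = U * A * (Uᵀ * U) * Aᵀ * Uᵀ := by
          simp only [hBdef, Matrix.transpose_mul, Matrix.transpose_transpose, Matrix.mul_assoc]
      _ = U * (A * Aᵀ) * Uᵀ := by rw [hU', Matrix.mul_one]; simp only [Matrix.mul_assoc]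
  have hsq : ∑ i, ∑ j, B i j ^ 2 = ∑ i, ∑ j, A i j ^ 2 := by
    rw [← trace_mul_transpose_self, ← trace_mul_transpose_self, hBB, Matrix.trace_mul_comm,
      ← Matrix.mul_assoc, hU', Matrix.one_mul]
  have hnorm : A *ᵥ e z ⬝ᵥ A *ᵥ e z = ∑ k, B z k ^ 2 := by
    have h1 : ∑ k, B z k ^ 2 = (B * Bᵀ) z z := by
      simp [Matrix.mul_apply, sq]
    have h2 : U * (A * Aᵀ) * Uᵀ = (A * Uᵀ)ᵀ * (A * Uᵀ) := by
      simp only [Matrix.transpose_mul, Matrix.transpose_transpose, hA.eq, Matrix.mul_assoc]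
    rw [h1, hBB, h2]
    rfl
  have hnorm' := Finset.add_sum_erase _ (fun k => B z k ^ 2) (Finset.mem_univ z)
  have htr' : B z z + ∑ k ∈ Finset.univ.erase z, B k k = A.trace :=
    (Finset.add_sum_erase _ (fun k => B k k) (Finset.mem_univ z)).trans htr
  have key := trace_sq_div_add_row_le hB z
  rw [htr, hsq] at key
  simp only [hBe, hnorm, ← sq, Finset.sum_sub_distrib, ← Finset.mul_sum]
  rw [← hnorm', eq_sub_of_add_eq' htr']
  linarith

theorem stmt_4 (n p : ℕ) (hn : 2 ≤ n) (hp : 1 ≤ p)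
    (Hm : Fin p → Matrix (Fin n) (Fin n) ℝ) (hsym : ∀ α, (Hm α).IsSymm) (c : ℝ)
    (e : Fin n → Fin n → ℝ)
    (he : ∀ i j, e i ⬝ᵥ e j = if i = j then (1 : ℝ) else 0) :
    ∑ k ∈ Finset.univ.filter (fun k : Fin n => 0 < (k : ℕ)),
        (2 * sffInner n p Hm (e ⟨0, by omega⟩) (e k) (e ⟨0, by omega⟩) (e k)
          - sffInner n p Hm (e ⟨0, by omega⟩) (e ⟨0, by omega⟩) (e k) (e k))
      ≤ (n : ℝ) * ((n : ℝ) - 1) / 2 * (c + meanCurvSq n p Hm)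
        - scalarCurv n p Hm c / 2 - ricci n p Hm c (e ⟨0, by omega⟩) + ((n : ℝ) - 1) * c := by
  have hn0 : (n : ℝ) ≠ 0 := by positivity
  set z : Fin n := ⟨0, by omega⟩ with hz
  have hfilter : Finset.univ.filter (fun k : Fin n => 0 < (k : ℕ)) = Finset.univ.erase z := by
    ext k
    simp [hz, Fin.ext_iff, Nat.pos_iff_ne_zero]
  have key := Finset.sum_le_sum fun α (_ : α ∈ Finset.univ) =>
    sum_sub_le_of_orthonormal (hsym α) he z
  have hmean : meanCurvSq n p Hm = (∑ α, (Hm α).trace ^ 2) / n ^ 2 := by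
    simp only [meanCurvSq, div_pow, Finset.sum_div]
  rw [Finset.sum_comm, Fintype.card_fin, Finset.sum_sub_distrib, Finset.sum_sub_distrib,
    ← Finset.sum_div, ← Finset.sum_div, ← Finset.sum_div] at key
  rw [hfilter]
  simp only [sffInner, sff, Finset.mul_sum, ← Finset.sum_sub_distrib]
  refine key.trans (le_of_eq ?_)
  rw [scalarCurv, ricci, hmean, sqNormSff]
  field_simp
  ring
end
end

section
/- Let n ≥ 2, p ≥ 1, let H_1,…,H_p be real symmetric n×n matrices and c a real number. Let e_1,…,e_n be an orthonormal basis of ℝⁿ. If R + 2·Ric(e_1) > n(n−1)(c+H²), then Σ_{k=2}^n [2‖h(e_1,e_k)‖² − ⟨h(e_1,e_1), h(e_k,e_k)⟩] < (n−1)c. -/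
open Matrix BigOperators

noncomputable section

/-- For a symmetric matrix, twice the squared norm of the off-diagonal part of one row plus
`(tr M)² / n` is at most the squared Frobenius norm. -/
theorem two_mul_sum_row_sq_add_trace_sq_div_le {ι : Type*} [Fintype ι] [DecidableEq ι]
    (M : Matrix ι ι ℝ) (hM : M.IsSymm) (i₀ : ι) :
    2 * ∑ k ∈ Finset.univ.erase i₀, M i₀ k ^ 2 + M.trace ^ 2 / Fintype.card ι
      ≤ ∑ i, ∑ j, M i j ^ 2 := by
  have hcard : (0 : ℝ) < Fintype.card ι := by
    exact_mod_cast Fintype.card_pos_iff.mpr ⟨i₀⟩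
  have hdiag : M.trace ^ 2 / Fintype.card ι ≤ ∑ i, M i i ^ 2 := by
    rw [div_le_iff₀ hcard, mul_comm]
    exact sq_sum_le_card_mul_sum_sq
  have hsplit : ∑ i, ∑ j, M i j ^ 2
      = ∑ i, M i i ^ 2 + ∑ i, ∑ j ∈ Finset.univ.erase i, M i j ^ 2 := by
    rw [← Finset.sum_add_distrib]
    exact Finset.sum_congr rfl fun i _ =>
      (Finset.add_sum_erase _ (fun j => M i j ^ 2) (Finset.mem_univ i)).symm
  have hcol : ∑ k ∈ Finset.univ.erase i₀, M i₀ k ^ 2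
      ≤ ∑ i ∈ Finset.univ.erase i₀, ∑ j ∈ Finset.univ.erase i, M i j ^ 2 := by
    refine Finset.sum_le_sum fun i hi => ?_
    rw [← hM.apply i₀ i]
    exact Finset.single_le_sum (f := fun j => M i j ^ 2) (fun j _ => sq_nonneg _)
      (Finset.mem_erase.mpr ⟨(Finset.ne_of_mem_erase hi).symm, Finset.mem_univ _⟩)
  have hrow := Finset.add_sum_erase Finset.univ
    (fun i => ∑ j ∈ Finset.univ.erase i, M i j ^ 2) (Finset.mem_univ i₀)
  linarith

theorem sum_sq_eq_trace_mul_transpose {ι : Type*} [Fintype ι] (M : Matrix ι ι ℝ) :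
    ∑ i, ∑ j, M i j ^ 2 = (M * Mᵀ).trace := by
  simp [Matrix.trace, Matrix.mul_apply, sq]

theorem sum_sq_conj_of_mul_transpose_eq_one {ι : Type*} [Fintype ι] [DecidableEq ι]
    (A E : Matrix ι ι ℝ) (hE : E * Eᵀ = 1) :
    ∑ i, ∑ j, (E * A * Eᵀ) i j ^ 2 = ∑ i, ∑ j, A i j ^ 2 := by
  have hE' : Eᵀ * E = 1 := mul_eq_one_comm.mp hE
  have h : E * A * Eᵀ * (E * A * Eᵀ)ᵀ = E * (A * Aᵀ * Eᵀ) := by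
    simp only [Matrix.transpose_mul, Matrix.transpose_transpose, Matrix.mul_assoc]
    rw [← Matrix.mul_assoc Eᵀ E, hE', Matrix.one_mul]
  rw [sum_sq_eq_trace_mul_transpose, sum_sq_eq_trace_mul_transpose, h, Matrix.trace_mul_comm,
    Matrix.mul_assoc, hE', Matrix.mul_one]

theorem trace_conj_of_mul_transpose_eq_one {ι : Type*} [Fintype ι] [DecidableEq ι]
    (A E : Matrix ι ι ℝ) (hE : E * Eᵀ = 1) : (E * A * Eᵀ).trace = A.trace := by
  have hE' : Eᵀ * E = 1 := mul_eq_one_comm.mp hE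
  rw [Matrix.trace_mul_comm, ← Matrix.mul_assoc, hE', Matrix.one_mul]

theorem conj_apply_eq_mulVec_dotProduct {ι : Type*} [Fintype ι]
    (A E : Matrix ι ι ℝ) (hA : A.IsSymm) (i j : ι) :
    (E * A * Eᵀ) i j = A *ᵥ E i ⬝ᵥ E j := by
  have h : (E * A) i = A *ᵥ E i := by
    rw [← Matrix.vecMul_transpose, hA.eq]
    rfl
  rw [← h]
  rfl

theorem dotProduct_self_eq_sum_sq {ι : Type*} [Fintype ι] [DecidableEq ι]
    (E : Matrix ι ι ℝ) (hE : E * Eᵀ = 1) (v : ι → ℝ) :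
    v ⬝ᵥ v = ∑ k, (v ⬝ᵥ E k) ^ 2 := by
  have hE' : Eᵀ * E = 1 := mul_eq_one_comm.mp hE
  have h : E *ᵥ v ⬝ᵥ E *ᵥ v = v ⬝ᵥ v := by
    rw [Matrix.dotProduct_mulVec, Matrix.vecMul_mulVec, hE', Matrix.vecMul_one]
  rw [← h]
  simp only [dotProduct, Matrix.mulVec, sq, mul_comm]

/-- The contribution of a single shape operator to the pinching estimate. -/
theorem two_mul_sum_sff_le {ι : Type*} [Fintype ι] [DecidableEq ι]
    (A E : Matrix ι ι ℝ) (hA : A.IsSymm) (hE : E * Eᵀ = 1) (i₀ : ι) :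
    2 * ∑ k ∈ Finset.univ.erase i₀,
        (2 * ((A *ᵥ E i₀ ⬝ᵥ E k) * (A *ᵥ E i₀ ⬝ᵥ E k))
          - (A *ᵥ E i₀ ⬝ᵥ E i₀) * (A *ᵥ E k ⬝ᵥ E k))
      ≤ ∑ i, ∑ j, A i j ^ 2 - A.trace ^ 2 / Fintype.card ι
        - 2 * (A.trace * (A *ᵥ E i₀ ⬝ᵥ E i₀) - A *ᵥ E i₀ ⬝ᵥ A *ᵥ E i₀) := by
  have hsymm : (E * A * Eᵀ).IsSymm := by
    simp [Matrix.IsSymm, Matrix.transpose_mul, hA.eq, Matrix.mul_assoc]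
  have key := two_mul_sum_row_sq_add_trace_sq_div_le _ hsymm i₀
  have htr := trace_conj_of_mul_transpose_eq_one A E hE
  rw [sum_sq_conj_of_mul_transpose_eq_one A E hE, htr] at key
  rw [dotProduct_self_eq_sum_sq E hE (A *ᵥ E i₀)]
  simp only [← conj_apply_eq_mulVec_dotProduct A E hA]
  generalize E * A * Eᵀ = M at *
  have hnorm := Finset.add_sum_erase Finset.univ (fun k => M i₀ k ^ 2) (Finset.mem_univ i₀)
  have htrace : M i₀ i₀ + ∑ k ∈ Finset.univ.erase i₀, M k k = A.trace :=
    (Finset.add_sum_erase Finset.univ (fun k => M k k) (Finset.mem_univ i₀)).trans htr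
  rw [Finset.sum_sub_distrib, ← Finset.mul_sum, ← Finset.mul_sum, ← hnorm]
  simp only [← sq]
  have hrest : ∑ k ∈ Finset.univ.erase i₀, M k k = A.trace - M i₀ i₀ := by linarith
  rw [hrest]
  linarith

theorem stmt_5 (n p : ℕ) (hn : 2 ≤ n) (hp : 1 ≤ p)
    (Hm : Fin p → Matrix (Fin n) (Fin n) ℝ) (hsym : ∀ α, (Hm α).IsSymm) (c : ℝ)
    (e : Fin n → Fin n → ℝ)
    (he : ∀ i j, e i ⬝ᵥ e j = if i = j then (1 : ℝ) else 0)
    (hpinch : scalarCurv n p Hm c + 2 * ricci n p Hm c (e ⟨0, by omega⟩)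
      > (n : ℝ) * ((n : ℝ) - 1) * (c + meanCurvSq n p Hm)) :
    ∑ k ∈ Finset.univ.filter (fun k : Fin n => 0 < (k : ℕ)),
        (2 * sffInner n p Hm (e ⟨0, by omega⟩) (e k) (e ⟨0, by omega⟩) (e k)
          - sffInner n p Hm (e ⟨0, by omega⟩) (e ⟨0, by omega⟩) (e k) (e k))
      < ((n : ℝ) - 1) * c := by
  have hE : Matrix.of e * (Matrix.of e)ᵀ = 1 := by
    ext i j
    rw [Matrix.one_apply, ← he i j]
    rfl
  have hfilter : Finset.univ.filter (fun k : Fin n => 0 < (k : ℕ))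
      = Finset.univ.erase ⟨0, by omega⟩ := by
    ext k
    simp [Fin.ext_iff, Nat.pos_iff_ne_zero]
  have hsum := Finset.sum_le_sum fun α (_ : α ∈ Finset.univ) =>
    two_mul_sum_sff_le (Hm α) (Matrix.of e) (hsym α) hE ⟨0, by omega⟩
  rw [← Finset.mul_sum, Finset.sum_comm, Finset.sum_sub_distrib, Finset.sum_sub_distrib,
    ← Finset.mul_sum, Fintype.card_fin, ← Finset.sum_div] at hsum
  have hn0 : (n : ℝ) ≠ 0 := by
    have : n ≠ 0 := by omega
    exact_mod_cast this
  have hmean : meanCurvSq n p Hm = (∑ α, (Hm α).trace ^ 2) / n ^ 2 := by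
    simp only [meanCurvSq, div_pow, Finset.sum_div]
  have hcoef : (n : ℝ) ^ 2 * meanCurvSq n p Hm - n * (n - 1) * meanCurvSq n p Hm
      = (∑ α, (Hm α).trace ^ 2) / n := by
    rw [hmean]
    field_simp
    ring
  rw [hfilter]
  simp only [sffInner, sff, Finset.mul_sum, ← Finset.sum_sub_distrib]
  simp only [scalarCurv, ricci, sqNormSff] at hpinch
  change 2 * ∑ k ∈ Finset.univ.erase _, ∑ α, (2 * ((Hm α *ᵥ e _ ⬝ᵥ e k) * (Hm α *ᵥ e _ ⬝ᵥ e k))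
    - (Hm α *ᵥ e _ ⬝ᵥ e _) * (Hm α *ᵥ e k ⬝ᵥ e k)) ≤ _ - _ - 2 * ∑ α, ((Hm α).trace *
    (Hm α *ᵥ e _ ⬝ᵥ e _) - Hm α *ᵥ e _ ⬝ᵥ Hm α *ᵥ e _) at hsum
  linarith
end
end

section
/- Let n ≥ 2, p ≥ 1, let H_1,…,H_p be real symmetric n×n matrices and c a real number. Let e_1,…,e_n be an orthonormal basis of ℝⁿ. If 3R − 2·Σ_{k=2}^n Ric(e_k) > n(n−1)(c+H²), then Σ_{k=2}^n [2‖h(e_1,e_k)‖² − ⟨h(e_1,e_1), h(e_k,e_k)⟩] < (n−1)c. -/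
open Matrix BigOperators

noncomputable section

section OrthonormalFrame

variable {n : ℕ} {e : Fin n → Fin n → ℝ}

lemma of_mul_transpose_eq_one (he : ∀ i j, e i ⬝ᵥ e j = if i = j then (1 : ℝ) else 0) :
    Matrix.of e * (Matrix.of e)ᵀ = 1 := by
  ext i j
  rw [Matrix.one_apply, ← he i j]
  rfl

/-- Parseval's identity for an orthonormal frame of `ℝⁿ`. -/
lemma sum_sq_dotProduct_frame (he : ∀ i j, e i ⬝ᵥ e j = if i = j then (1 : ℝ) else 0)
    (v : Fin n → ℝ) : ∑ j, (v ⬝ᵥ e j) ^ 2 = v ⬝ᵥ v := by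
  have h1 : (Matrix.of e)ᵀ * Matrix.of e = 1 :=
    mul_eq_one_comm.mp (of_mul_transpose_eq_one he)
  have h2 : ∑ j, (v ⬝ᵥ e j) ^ 2 = (Matrix.of e *ᵥ v) ⬝ᵥ (Matrix.of e *ᵥ v) := by
    refine Finset.sum_congr rfl fun j _ => ?_
    rw [dotProduct_comm v, sq]
    rfl
  rw [h2, dotProduct_mulVec, vecMul_mulVec, ← dotProduct_mulVec, h1, one_mulVec]

lemma sum_mulVec_dotProduct_frame (he : ∀ i j, e i ⬝ᵥ e j = if i = j then (1 : ℝ) else 0)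
    (K : Matrix (Fin n) (Fin n) ℝ) : ∑ k, K *ᵥ e k ⬝ᵥ e k = K.trace := by
  have h1 : (Matrix.of e)ᵀ * Matrix.of e = 1 :=
    mul_eq_one_comm.mp (of_mul_transpose_eq_one he)
  have h2 : (Matrix.of e * (K * (Matrix.of e)ᵀ)).trace = K.trace := by
    rw [Matrix.trace_mul_comm, Matrix.mul_assoc, h1, Matrix.mul_one]
  rw [← h2]
  refine Finset.sum_congr rfl fun k _ => ?_
  rw [dotProduct_comm]
  rfl

lemma sum_normSq_mulVec_frame (he : ∀ i j, e i ⬝ᵥ e j = if i = j then (1 : ℝ) else 0)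
    (K : Matrix (Fin n) (Fin n) ℝ) :
    ∑ k, K *ᵥ e k ⬝ᵥ K *ᵥ e k = ∑ i, ∑ j, K i j ^ 2 := by
  have h (k : Fin n) : K *ᵥ e k ⬝ᵥ K *ᵥ e k = ∑ i, (K i ⬝ᵥ e k) ^ 2 :=
    Finset.sum_congr rfl fun i _ => (sq _).symm
  simp_rw [h]
  rw [Finset.sum_comm]
  refine Finset.sum_congr rfl fun i _ => ?_
  rw [sum_sq_dotProduct_frame he]
  exact Finset.sum_congr rfl fun j _ => (sq _).symm

end OrthonormalFrame

/-- The squared Frobenius norm of a symmetric array dominates its diagonal together with twice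
the off-diagonal part of one row. -/
lemma diag_add_two_mul_row_le_sum_sq {ι : Type*} [Fintype ι] [DecidableEq ι] (m : ι → ι → ℝ)
    (hm : ∀ i j, m i j = m j i) (z : ι) :
    ∑ i, m i i ^ 2 + 2 * ∑ k ∈ Finset.univ.erase z, m z k ^ 2 ≤ ∑ i, ∑ j, m i j ^ 2 := by
  have hrow : ∑ i ∈ Finset.univ.erase z, (m i i ^ 2 + m z i ^ 2)
      ≤ ∑ i ∈ Finset.univ.erase z, ∑ j, m i j ^ 2 := by
    refine Finset.sum_le_sum fun i hi => ?_
    rw [hm z i, ← Finset.sum_pair (f := fun j => m i j ^ 2) (Finset.ne_of_mem_erase hi)]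
    exact Finset.sum_le_sum_of_subset_of_nonneg (Finset.subset_univ _)
      fun _ _ _ => sq_nonneg _
  rw [Finset.sum_add_distrib] at hrow
  have h1 := Finset.add_sum_erase Finset.univ (fun i => ∑ j, m i j ^ 2) (Finset.mem_univ z)
  have h2 := Finset.add_sum_erase Finset.univ (fun j => m z j ^ 2) (Finset.mem_univ z)
  have h3 := Finset.add_sum_erase Finset.univ (fun j => m j j ^ 2) (Finset.mem_univ z)
  linarith

/-- The Lawson–Simons estimate for a single shape operator. -/
lemma lawsonSimons_shapeOperator_le {n : ℕ} {e : Fin n → Fin n → ℝ}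
    (he : ∀ i j, e i ⬝ᵥ e j = if i = j then (1 : ℝ) else 0)
    {K : Matrix (Fin n) (Fin n) ℝ} (hK : K.IsSymm) (z : Fin n) :
    2 * ∑ k ∈ Finset.univ.erase z,
        (2 * ((K *ᵥ e z ⬝ᵥ e k) * (K *ᵥ e z ⬝ᵥ e k)) - (K *ᵥ e z ⬝ᵥ e z) * (K *ᵥ e k ⬝ᵥ e k))
      ≤ n * (n - 1) * (K.trace / n) ^ 2
        + 2 * ∑ k ∈ Finset.univ.erase z,
            (K.trace * (K *ᵥ e k ⬝ᵥ e k) - K *ᵥ e k ⬝ᵥ K *ᵥ e k)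
        - 3 * (K.trace ^ 2 - ∑ i, ∑ j, K i j ^ 2) := by
  have hn : (0 : ℝ) < n := by exact_mod_cast z.pos
  have hsymm (i j : Fin n) : K *ᵥ e i ⬝ᵥ e j = K *ᵥ e j ⬝ᵥ e i := by
    rw [dotProduct_comm, dotProduct_mulVec, ← mulVec_transpose, hK.eq]
  have htr := sum_mulVec_dotProduct_frame he K
  have hfro := sum_normSq_mulVec_frame he K
  have hle := diag_add_two_mul_row_le_sum_sq (fun i j => K *ᵥ e i ⬝ᵥ e j) hsymm z
  have hcs := sq_sum_le_card_mul_sum_sq (s := Finset.univ) (f := fun k => K *ᵥ e k ⬝ᵥ e k)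
  have hpars := sum_sq_dotProduct_frame he (K *ᵥ e z)
  simp only [sum_sq_dotProduct_frame he, hfro] at hle
  rw [htr, Finset.card_univ, Fintype.card_fin, ← div_le_iff₀' hn] at hcs
  have htr' := Finset.add_sum_erase Finset.univ (fun k => K *ᵥ e k ⬝ᵥ e k) (Finset.mem_univ z)
  have hfro' := Finset.add_sum_erase Finset.univ (fun k => K *ᵥ e k ⬝ᵥ K *ᵥ e k)
    (Finset.mem_univ z)
  rw [← Finset.add_sum_erase Finset.univ _ (Finset.mem_univ z)] at hpars
  rw [htr] at htr'
  rw [hfro] at hfro'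
  have hT : (n : ℝ) * (n - 1) * (K.trace / n) ^ 2 = K.trace ^ 2 - K.trace ^ 2 / n := by
    field_simp
  simp only [Finset.sum_sub_distrib, ← Finset.mul_sum, ← sq]
  rw [hT, eq_sub_of_add_eq' htr', eq_sub_of_add_eq' hfro', ← hpars]
  linarith

theorem stmt_6 (n p : ℕ) (hn : 2 ≤ n) (hp : 1 ≤ p)
    (Hm : Fin p → Matrix (Fin n) (Fin n) ℝ) (hsym : ∀ α, (Hm α).IsSymm) (c : ℝ)
    (e : Fin n → Fin n → ℝ)
    (he : ∀ i j, e i ⬝ᵥ e j = if i = j then (1 : ℝ) else 0)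
    (hpinch : 3 * scalarCurv n p Hm c
        - 2 * ∑ k ∈ Finset.univ.filter (fun k : Fin n => 0 < (k : ℕ)), ricci n p Hm c (e k)
      > (n : ℝ) * ((n : ℝ) - 1) * (c + meanCurvSq n p Hm)) :
    ∑ k ∈ Finset.univ.filter (fun k : Fin n => 0 < (k : ℕ)),
        (2 * sffInner n p Hm (e ⟨0, by omega⟩) (e k) (e ⟨0, by omega⟩) (e k)
          - sffInner n p Hm (e ⟨0, by omega⟩) (e ⟨0, by omega⟩) (e k) (e k))
      < ((n : ℝ) - 1) * c := by
  have hn0 : (n : ℝ) ≠ 0 := by positivity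
  have hfilter : Finset.univ.filter (fun k : Fin n => 0 < (k : ℕ))
      = Finset.univ.erase ⟨0, by omega⟩ := by
    ext k
    simp [Fin.ext_iff, Nat.pos_iff_ne_zero]
  have hcard : ((Finset.univ.erase (⟨0, by omega⟩ : Fin n)).card : ℝ) = n - 1 := by
    rw [Finset.card_erase_of_mem (Finset.mem_univ _), Finset.card_univ, Fintype.card_fin,
      Nat.cast_pred (by omega)]
  have hsq : (n : ℝ) ^ 2 * meanCurvSq n p Hm = ∑ α, (Hm α).trace ^ 2 := by
    rw [meanCurvSq, Finset.mul_sum]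
    exact Finset.sum_congr rfl fun α _ => by field_simp
  have hsum := Finset.sum_le_sum fun α (_ : α ∈ Finset.univ) =>
    lawsonSimons_shapeOperator_le he (hsym α) ⟨0, by omega⟩
  simp only [Finset.sum_add_distrib,
    Finset.sum_sub_distrib (s := (Finset.univ : Finset (Fin p))), ← Finset.mul_sum,
    Finset.sum_comm (s := (Finset.univ : Finset (Fin p)))
      (t := Finset.univ.erase (⟨0, by omega⟩ : Fin n))] at hsum
  rw [← hsq] at hsum
  rw [hfilter] at hpinch ⊢
  simp only [ricci, Finset.sum_add_distrib, Finset.sum_const, nsmul_eq_mul, hcard,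
    Finset.sum_sub_distrib, scalarCurv, sqNormSff] at hpinch
  simp only [sffInner, sff, Finset.sum_sub_distrib, ← Finset.mul_sum]
  simp only [Finset.sum_sub_distrib, ← Finset.mul_sum] at hsum
  rw [← meanCurvSq] at hsum
  linarith
end
end

section
/- Let n ≥ 4, p ≥ 1, let H_1,…,H_p be real symmetric n×n matrices, c a real number, and let q be an integer with 2 ≤ q ≤ n/2. For every orthonormal basis e_1,…,e_n of ℝⁿ, Σ_{k=q+1}^n Σ_{i=1}^q [2‖h(e_i,e_k)‖² − ⟨h(e_i,e_i), h(e_k,e_k)⟩] − q(n−q)c ≤ −((n−2q)/(n−2))·Σ_{i=1}^q Ric(e_i) − ((n−q)(q−1)/(n−2))·R + (n²(n−q−1)(q−1)/(n−2))·(c+H²). -/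
open Matrix BigOperators

noncomputable section

/-- The squared trace of a real square block is at most its size times its squared Frobenius
norm. -/
theorem sq_sum_diag_le_card_mul_sum_sq {ι : Type*} (B : Matrix ι ι ℝ) (s : Finset ι) :
    (∑ i ∈ s, B i i) ^ 2 ≤ s.card * ∑ i ∈ s, ∑ j ∈ s, B i j ^ 2 :=
  sq_sum_le_card_mul_sum_sq.trans <| mul_le_mul_of_nonneg_left
    (Finset.sum_le_sum fun i hi =>
      Finset.single_le_sum (f := fun j => B i j ^ 2) (fun j _ => sq_nonneg (B i j)) hi)
    (Nat.cast_nonneg _)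

/-- The block estimate for one symmetric matrix, with respect to the splitting of the index type
into `s` and its complement. -/
theorem block_estimate {ι : Type*} [Fintype ι] [DecidableEq ι] {B : Matrix ι ι ℝ}
    (hB : B.IsSymm) (s : Finset ι) (hs : 2 ≤ s.card) (hs' : 2 * s.card ≤ Fintype.card ι) :
    ((Fintype.card ι : ℝ) - 2) * ∑ k ∈ sᶜ, ∑ i ∈ s, (2 * B i k ^ 2 - B i i * B k k)
      ≤ -((Fintype.card ι : ℝ) - 2 * s.card) *
            ∑ i ∈ s, (B.trace * B i i - ∑ j, B i j ^ 2)
        - ((Fintype.card ι : ℝ) - s.card) * ((s.card : ℝ) - 1) *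
            (B.trace ^ 2 - ∑ i, ∑ j, B i j ^ 2)
        + ((Fintype.card ι : ℝ) - s.card - 1) * ((s.card : ℝ) - 1) * B.trace ^ 2 := by
  have hcard : ((sᶜ.card : ℕ) : ℝ) = (Fintype.card ι : ℝ) - s.card := by
    rw [Finset.card_compl, Nat.cast_sub s.card_le_univ]
  have hU := sq_sum_diag_le_card_mul_sum_sq B s
  have hV := sq_sum_diag_le_card_mul_sum_sq B sᶜ
  rw [hcard] at hV
  have hM : 0 ≤ ∑ i ∈ s, ∑ k ∈ sᶜ, B i k ^ 2 :=
    Finset.sum_nonneg fun i _ => Finset.sum_nonneg fun k _ => sq_nonneg _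
  have hM' : ∑ k ∈ sᶜ, ∑ i ∈ s, B k i ^ 2 = ∑ i ∈ s, ∑ k ∈ sᶜ, B i k ^ 2 := by
    rw [Finset.sum_comm]
    simp_rw [fun i k => hB.apply i k]
  have htr : B.trace = ∑ i ∈ s, B i i + ∑ k ∈ sᶜ, B k k :=
    (Finset.sum_add_sum_compl s _).symm
  have hrow (i : ι) : ∑ j, B i j ^ 2 = ∑ j ∈ s, B i j ^ 2 + ∑ j ∈ sᶜ, B i j ^ 2 :=
    (Finset.sum_add_sum_compl s _).symm
  have htot : ∑ i, ∑ j, B i j ^ 2 = ∑ i ∈ s, ∑ j, B i j ^ 2 + ∑ i ∈ sᶜ, ∑ j, B i j ^ 2 :=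
    (Finset.sum_add_sum_compl s _).symm
  have hL : ∑ k ∈ sᶜ, ∑ i ∈ s, (2 * B i k ^ 2 - B i i * B k k)
      = 2 * ∑ i ∈ s, ∑ k ∈ sᶜ, B i k ^ 2 - (∑ i ∈ s, B i i) * ∑ k ∈ sᶜ, B k k := by
    rw [Finset.sum_comm, Finset.sum_mul_sum, Finset.mul_sum]
    simp_rw [Finset.mul_sum, Finset.sum_sub_distrib]
  rw [hL, htot, Finset.sum_sub_distrib, ← Finset.mul_sum, htr]
  simp_rw [hrow, Finset.sum_add_distrib]
  rw [hM']
  have hq : (2 : ℝ) ≤ s.card := by exact_mod_cast hs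
  have hn : 2 * (s.card : ℝ) ≤ Fintype.card ι := by exact_mod_cast hs'
  generalize (s.card : ℝ) = q at *
  generalize (Fintype.card ι : ℝ) = n at *
  have h1 := mul_le_mul_of_nonneg_left hU (by linarith : 0 ≤ n - q - 1)
  have h2 := mul_le_mul_of_nonneg_left hV (by linarith : 0 ≤ q - 1)
  have hcoef : 0 ≤ n * (2 * q - 3) - 2 * q ^ 2 + 4 := by
    nlinarith [mul_nonneg (sub_nonneg.2 hn) (by linarith : 0 ≤ 2 * q - 3),
      mul_nonneg (by linarith : 0 ≤ q - 1) (sub_nonneg.2 hq)]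
  have h3 := mul_nonneg hcoef hM
  linear_combination h1 + h2 + h3

theorem mul_mul_transpose_apply_eq_mulVec_dotProduct {ι : Type*} [Fintype ι] {E A : Matrix ι ι ℝ}
    (hA : A.IsSymm) (i j : ι) :
    (E * A * Eᵀ) i j = A *ᵥ E i ⬝ᵥ E j := by
  rw [Matrix.mul_apply]
  simp only [Matrix.mul_apply, Matrix.mulVec, dotProduct, Matrix.transpose_apply]
  refine Finset.sum_congr rfl fun k _ => ?_
  congr 1
  refine Finset.sum_congr rfl fun l _ => ?_
  rw [hA.apply l k, mul_comm]

theorem trace_mul_mul_transpose {ι : Type*} [Fintype ι] [DecidableEq ι] {E : Matrix ι ι ℝ}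
    (hE : E * Eᵀ = 1) (A : Matrix ι ι ℝ) :
    (E * A * Eᵀ).trace = A.trace := by
  rw [Matrix.trace_mul_comm, ← Matrix.mul_assoc, mul_eq_one_comm.1 hE, Matrix.one_mul]

theorem sum_sq_mulVec_dotProduct {ι : Type*} [Fintype ι] [DecidableEq ι] {E : Matrix ι ι ℝ}
    (hE : E * Eᵀ = 1) (v : ι → ℝ) :
    ∑ j, (v ⬝ᵥ E j) ^ 2 = v ⬝ᵥ v := by
  have h : ∑ j, (v ⬝ᵥ E j) ^ 2 = (E *ᵥ v) ⬝ᵥ (E *ᵥ v) :=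
    Finset.sum_congr rfl fun j _ => by rw [sq, dotProduct_comm]; rfl
  rw [h, Matrix.dotProduct_mulVec, ← Matrix.mulVec_transpose, Matrix.mulVec_mulVec,
    mul_eq_one_comm.1 hE, Matrix.one_mulVec]

theorem sum_sq_mul_mul_transpose {ι : Type*} [Fintype ι] [DecidableEq ι] {E : Matrix ι ι ℝ}
    (hE : E * Eᵀ = 1) (A : Matrix ι ι ℝ) :
    ∑ i, ∑ j, (E * A * Eᵀ) i j ^ 2 = ∑ i, ∑ j, A i j ^ 2 := by
  have h (C : Matrix ι ι ℝ) : ∑ i, ∑ j, C i j ^ 2 = (C * Cᵀ).trace := by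
    simp [Matrix.trace, Matrix.mul_apply, sq]
  have hE' : Eᵀ * E = 1 := mul_eq_one_comm.1 hE
  have hC : (E * A * Eᵀ) * (E * A * Eᵀ)ᵀ = E * (A * Aᵀ) * Eᵀ := by
    simp only [Matrix.transpose_mul, Matrix.transpose_transpose, Matrix.mul_assoc]
    rw [← Matrix.mul_assoc Eᵀ E, hE', Matrix.one_mul]
  rw [h, h, hC, trace_mul_mul_transpose hE]

theorem stmt_8 (n p : ℕ) (hn : 4 ≤ n) (hp : 1 ≤ p)
    (Hm : Fin p → Matrix (Fin n) (Fin n) ℝ) (hsym : ∀ α, (Hm α).IsSymm) (c : ℝ)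
    (q : ℕ) (hq : 2 ≤ q) (hq2 : 2 * q ≤ n)
    (e : Fin n → Fin n → ℝ)
    (he : ∀ i j, e i ⬝ᵥ e j = if i = j then (1 : ℝ) else 0) :
    (∑ k ∈ Finset.univ.filter (fun k : Fin n => q ≤ (k : ℕ)),
        ∑ i ∈ Finset.univ.filter (fun i : Fin n => (i : ℕ) < q),
          (2 * sffInner n p Hm (e i) (e k) (e i) (e k)
            - sffInner n p Hm (e i) (e i) (e k) (e k)))
        - (q : ℝ) * ((n : ℝ) - q) * c
      ≤ -(((n : ℝ) - 2 * q) / ((n : ℝ) - 2)) *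
            ∑ i ∈ Finset.univ.filter (fun i : Fin n => (i : ℕ) < q), ricci n p Hm c (e i)
        - ((n : ℝ) - q) * ((q : ℝ) - 1) / ((n : ℝ) - 2) * scalarCurv n p Hm c
        + (n : ℝ) ^ 2 * ((n : ℝ) - q - 1) * ((q : ℝ) - 1) / ((n : ℝ) - 2)
            * (c + meanCurvSq n p Hm) := by
  have hn0 : (n : ℝ) ≠ 0 := by positivity
  have hn2 : (0 : ℝ) < n - 2 := by
    have : (4 : ℝ) ≤ n := by exact_mod_cast hn
    linarith
  set s : Finset (Fin n) := Finset.univ.filter (fun i : Fin n => (i : ℕ) < q) with hs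
  have hsc : Finset.univ.filter (fun k : Fin n => q ≤ (k : ℕ)) = sᶜ := by
    ext k
    simp [hs]
  have hcard : s.card = q := by
    rw [hs, Fin.card_filter_val_lt]
    omega
  let E : Matrix (Fin n) (Fin n) ℝ := Matrix.of e
  have hE : E * Eᵀ = 1 := by
    ext i j
    rw [Matrix.one_apply, ← he i j]
    rfl
  have hentry (α : Fin p) (i j : Fin n) :
      (E * Hm α * Eᵀ) i j = Hm α *ᵥ e i ⬝ᵥ e j :=
    mul_mul_transpose_apply_eq_mulVec_dotProduct (hsym α) i j
  have hrow (α : Fin p) (i : Fin n) :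
      ∑ j, (E * Hm α * Eᵀ) i j ^ 2 = Hm α *ᵥ e i ⬝ᵥ Hm α *ᵥ e i := by
    simp_rw [hentry]
    exact sum_sq_mulVec_dotProduct hE _
  have hα := Finset.sum_le_sum fun α (_ : α ∈ Finset.univ) =>
    block_estimate (B := E * Hm α * Eᵀ)
      (by simp [Matrix.IsSymm, Matrix.transpose_mul, (hsym α).eq, Matrix.mul_assoc]) s
      (by omega) (by rw [Fintype.card_fin]; omega)
  simp only [sum_sq_mul_mul_transpose hE] at hα
  simp only [hrow] at hα
  simp only [trace_mul_mul_transpose hE, hentry, hcard,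
    Fintype.card_fin, ← Finset.mul_sum, Finset.sum_add_distrib, Finset.sum_sub_distrib] at hα
  have hH : (n : ℝ) ^ 2 * meanCurvSq n p Hm = ∑ α, (Hm α).trace ^ 2 := by
    rw [meanCurvSq, Finset.mul_sum]
    exact Finset.sum_congr rfl fun α _ => by field_simp
  have hRic : ∑ i ∈ s, ricci n p Hm c (e i) = q * ((n - 1) * c)
      + (∑ α, (Hm α).trace * ∑ i ∈ s, (Hm α *ᵥ e i ⬝ᵥ e i)
        - ∑ α, ∑ i ∈ s, (Hm α *ᵥ e i ⬝ᵥ Hm α *ᵥ e i)) := by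
    simp only [ricci, Finset.sum_add_distrib, Finset.sum_const, hcard, nsmul_eq_mul,
      Finset.sum_sub_distrib, Finset.mul_sum]
    congr 2
    · exact Finset.sum_comm
    · exact Finset.sum_comm
  have hLHS : (∑ k ∈ sᶜ, ∑ i ∈ s, (2 * sffInner n p Hm (e i) (e k) (e i) (e k)
        - sffInner n p Hm (e i) (e i) (e k) (e k)))
      = ∑ α, ∑ k ∈ sᶜ, ∑ i ∈ s, (2 * (Hm α *ᵥ e i ⬝ᵥ e k) ^ 2
        - (Hm α *ᵥ e i ⬝ᵥ e i) * (Hm α *ᵥ e k ⬝ᵥ e k)) := by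
    symm
    rw [Finset.sum_comm]
    refine Finset.sum_congr rfl fun k _ => ?_
    rw [Finset.sum_comm]
    refine Finset.sum_congr rfl fun i _ => ?_
    simp only [sffInner, sff, Finset.sum_sub_distrib, Finset.mul_sum, sq]
  rw [hsc, hRic, scalarCurv, sqNormSff]
  rw [← hH] at hα
  simp only [Finset.sum_sub_distrib, ← Finset.mul_sum] at hLHS ⊢
  rw [hLHS, ← sub_nonneg]
  refine (div_nonneg (sub_nonneg.2 hα) hn2.le).trans_eq ?_
  have := hn2.ne'
  field_simp
  ring
end
end

section
/- Let n ≥ 4, p ≥ 1, let H_1,…,H_p be real symmetric n×n matrices, c a real number, and let q be an integer with 2 ≤ q ≤ n/2. Let e_1,…,e_n be an orthonormal basis of ℝⁿ. If q(n−q−1)·R − (n−2q)·Σ_{k=q+1}^n Ric(e_k) > n²(n−q−1)(q−1)(c+H²), then Σ_{k=q+1}^n Σ_{i=1}^q [2‖h(e_i,e_k)‖² − ⟨h(e_i,e_i), h(e_k,e_k)⟩] < q(n−q)c. -/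
open Matrix BigOperators

noncomputable section

theorem transpose_mul_self_of_orthonormal {n : ℕ} {e : Fin n → Fin n → ℝ}
    (he : ∀ i j, e i ⬝ᵥ e j = if i = j then (1 : ℝ) else 0) :
    (Matrix.of e)ᵀ * Matrix.of e = 1 := by
  rw [mul_eq_one_comm]
  ext i j
  rw [Matrix.one_apply, ← he i j]
  rfl

/-- Parseval's identity. -/
theorem dotProduct_self_eq_sum_sq_s10 {n : ℕ} {e : Fin n → Fin n → ℝ}
    (he : ∀ i j, e i ⬝ᵥ e j = if i = j then (1 : ℝ) else 0) (v : Fin n → ℝ) :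
    v ⬝ᵥ v = ∑ j, (v ⬝ᵥ e j) ^ 2 := by
  have h : v ⬝ᵥ v = (Matrix.of e *ᵥ v) ⬝ᵥ (Matrix.of e *ᵥ v) := by
    rw [Matrix.dotProduct_mulVec, Matrix.vecMul_mulVec, transpose_mul_self_of_orthonormal he,
      Matrix.vecMul_one]
  rw [h, dotProduct]
  refine Finset.sum_congr rfl fun j _ => ?_
  rw [sq, dotProduct_comm v (e j)]
  rfl

theorem trace_eq_sum_of_orthonormal {n : ℕ} {e : Fin n → Fin n → ℝ}
    (he : ∀ i j, e i ⬝ᵥ e j = if i = j then (1 : ℝ) else 0) (A : Matrix (Fin n) (Fin n) ℝ) :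
    A.trace = ∑ i, (A *ᵥ e i) ⬝ᵥ e i := by
  calc A.trace = (A * ((Matrix.of e)ᵀ * Matrix.of e)).trace := by
        rw [transpose_mul_self_of_orthonormal he, Matrix.mul_one]
    _ = (Matrix.of e * (A * (Matrix.of e)ᵀ)).trace := by
        rw [← Matrix.mul_assoc, Matrix.trace_mul_comm]
    _ = ∑ i, (A *ᵥ e i) ⬝ᵥ e i :=
        Finset.sum_congr rfl fun i _ => dotProduct_comm (e i) (A *ᵥ e i)

theorem sum_sq_eq_of_orthonormal {n : ℕ} {e : Fin n → Fin n → ℝ}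
    (he : ∀ i j, e i ⬝ᵥ e j = if i = j then (1 : ℝ) else 0) (A : Matrix (Fin n) (Fin n) ℝ) :
    ∑ i, ∑ j, A i j ^ 2 = ∑ i, (A *ᵥ e i) ⬝ᵥ (A *ᵥ e i) := by
  have h : ∑ i, ∑ j, A i j ^ 2 = (Aᵀ * A).trace := by
    rw [Finset.sum_comm]
    simp [Matrix.trace, Matrix.mul_apply, sq]
  rw [h, trace_eq_sum_of_orthonormal he]
  refine Finset.sum_congr rfl fun i _ => ?_
  rw [← Matrix.mulVec_mulVec, Matrix.mulVec_transpose, ← Matrix.dotProduct_mulVec]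

theorem mulVec_dotProduct_comm_of_isSymm {n : ℕ} {A : Matrix (Fin n) (Fin n) ℝ} (hA : A.IsSymm)
    (u v : Fin n → ℝ) : (A *ᵥ u) ⬝ᵥ v = (A *ᵥ v) ⬝ᵥ u := by
  rw [dotProduct_comm, Matrix.dotProduct_mulVec, ← Matrix.mulVec_transpose, hA.eq]

/-- The squared trace of a square block is at most its size times its squared Frobenius norm. -/
theorem sq_sum_diag_le {ι : Type*} (s : Finset ι) (B : ι → ι → ℝ) :
    (∑ i ∈ s, B i i) ^ 2 ≤ (s.card : ℝ) * ∑ i ∈ s, ∑ j ∈ s, B i j ^ 2 := by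
  refine sq_sum_le_card_mul_sum_sq.trans ?_
  refine mul_le_mul_of_nonneg_left (Finset.sum_le_sum fun i hi => ?_) (Nat.cast_nonneg _)
  exact Finset.single_le_sum (f := fun j => B i j ^ 2) (fun j _ => sq_nonneg _) hi

/-- The block inequality for a symmetric array split along `s` and its complement. -/
theorem block_inequality {n : ℕ} (B : Fin n → Fin n → ℝ) (hB : ∀ i j, B i j = B j i)
    (s : Finset (Fin n)) {q m : ℝ} (hq : 2 ≤ q) (hm : 2 ≤ m)
    (hqc : (sᶜ.card : ℝ) = q) (hmc : (s.card : ℝ) = m) :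
    (q + m - 2) * ∑ k ∈ s, ∑ i ∈ sᶜ, (2 * (B i k * B i k) - B i i * B k k) ≤
      q * (m - 1) * (∑ i, ∑ j, B i j ^ 2) - (m - 1) * (∑ i, B i i) ^ 2
        + (m - q) * ∑ k ∈ s, ((∑ i, B i i) * B k k - ∑ j, B k j ^ 2) := by
  have hP := sq_sum_diag_le sᶜ B
  have hQ := sq_sum_diag_le s B
  have hM : 0 ≤ ∑ k ∈ s, ∑ i ∈ sᶜ, B k i ^ 2 :=
    Finset.sum_nonneg fun k _ => Finset.sum_nonneg fun i _ => sq_nonneg _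
  have hM' : ∑ i ∈ sᶜ, ∑ k ∈ s, B i k ^ 2 = ∑ k ∈ s, ∑ i ∈ sᶜ, B k i ^ 2 := by
    rw [Finset.sum_comm]
    simp only [hB]
  have hL : ∑ k ∈ s, ∑ i ∈ sᶜ, (2 * (B i k * B i k) - B i i * B k k) =
      2 * (∑ k ∈ s, ∑ i ∈ sᶜ, B k i ^ 2) - (∑ i ∈ sᶜ, B i i) * ∑ k ∈ s, B k k := by
    rw [mul_comm (∑ i ∈ sᶜ, B i i), Finset.sum_mul_sum, Finset.mul_sum, ← Finset.sum_sub_distrib]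
    refine Finset.sum_congr rfl fun k _ => ?_
    rw [Finset.mul_sum, ← Finset.sum_sub_distrib]
    refine Finset.sum_congr rfl fun i _ => ?_
    rw [hB i k]
    ring
  have hrow : ∀ i, ∑ j, B i j ^ 2 = ∑ j ∈ s, B i j ^ 2 + ∑ j ∈ sᶜ, B i j ^ 2 := fun i =>
    (Finset.sum_add_sum_compl s _).symm
  rw [hL, Finset.sum_sub_distrib, ← Finset.mul_sum, ← Finset.sum_add_sum_compl s (fun i => B i i),
    ← Finset.sum_add_sum_compl s (fun i => ∑ j, B i j ^ 2)]
  simp only [hrow, Finset.sum_add_distrib]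
  rw [hM']
  rw [hqc] at hP
  rw [hmc] at hQ
  generalize (∑ k ∈ s, ∑ i ∈ sᶜ, B k i ^ 2) = M at *
  generalize (∑ i ∈ sᶜ, ∑ j ∈ sᶜ, B i j ^ 2) = P at *
  generalize (∑ i ∈ s, ∑ j ∈ s, B i j ^ 2) = Q at *
  generalize (∑ i ∈ sᶜ, B i i) = X at *
  generalize (∑ i ∈ s, B i i) = Y at *
  have h1 := mul_le_mul_of_nonneg_left hP (by linarith : 0 ≤ m - 1)
  have h2 := mul_le_mul_of_nonneg_left hQ (by linarith : 0 ≤ q - 1)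
  have h3 : 0 ≤ (2 * ((q - 2) * (m - 2)) + (q - 2) + (m - 2)) * M :=
    mul_nonneg (by nlinarith [mul_nonneg (sub_nonneg.2 hq) (sub_nonneg.2 hm)]) hM
  nlinarith

theorem stmt_10 (n p : ℕ) (hn : 4 ≤ n) (hp : 1 ≤ p)
    (Hm : Fin p → Matrix (Fin n) (Fin n) ℝ) (hsym : ∀ α, (Hm α).IsSymm) (c : ℝ)
    (q : ℕ) (hq : 2 ≤ q) (hq2 : 2 * q ≤ n)
    (e : Fin n → Fin n → ℝ)
    (he : ∀ i j, e i ⬝ᵥ e j = if i = j then (1 : ℝ) else 0)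
    (hpinch : (q : ℝ) * ((n : ℝ) - q - 1) * scalarCurv n p Hm c
        - ((n : ℝ) - 2 * q) *
            ∑ k ∈ Finset.univ.filter (fun k : Fin n => q ≤ (k : ℕ)), ricci n p Hm c (e k)
      > (n : ℝ) ^ 2 * ((n : ℝ) - q - 1) * ((q : ℝ) - 1) * (c + meanCurvSq n p Hm)) :
    ∑ k ∈ Finset.univ.filter (fun k : Fin n => q ≤ (k : ℕ)),
        ∑ i ∈ Finset.univ.filter (fun i : Fin n => (i : ℕ) < q),
          (2 * sffInner n p Hm (e i) (e k) (e i) (e k)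
            - sffInner n p Hm (e i) (e i) (e k) (e k))
      < (q : ℝ) * ((n : ℝ) - q) * c := by
  have hn0 : (n : ℝ) ≠ 0 := by positivity
  have hq' : (2 : ℝ) ≤ q := by exact_mod_cast hq
  have hn' : (2 : ℝ) * q ≤ n := by exact_mod_cast hq2
  set s : Finset (Fin n) := Finset.univ.filter (fun k : Fin n => q ≤ (k : ℕ)) with hs
  have hsc : Finset.univ.filter (fun i : Fin n => (i : ℕ) < q) = sᶜ := by
    ext i
    simp [hs]
  have hqc : (sᶜ.card : ℝ) = q := by
    rw [← hsc, Fin.card_filter_val_lt, min_eq_right (by omega)]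
  have hmc : (s.card : ℝ) = n - q := by
    have h := s.card_add_card_compl
    rw [Fintype.card_fin] at h
    rw [← hqc, eq_sub_iff_add_eq]
    exact_mod_cast h
  rw [hsc]
  have hH : (n : ℝ) ^ 2 * meanCurvSq n p Hm = ∑ α, (Hm α).trace ^ 2 := by
    rw [meanCurvSq, Finset.mul_sum]
    refine Finset.sum_congr rfl fun α _ => ?_
    field_simp
  have hblock := Finset.sum_le_sum fun α (_ : α ∈ Finset.univ) =>
    block_inequality (fun i j => (Hm α *ᵥ e i) ⬝ᵥ e j)
      (fun i j => mulVec_dotProduct_comm_of_isSymm (hsym α) (e i) (e j)) s hq'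
      (by linarith) hqc hmc
  simp only [← trace_eq_sum_of_orthonormal he, ← sum_sq_eq_of_orthonormal he,
    ← dotProduct_self_eq_sum_sq_s10 he, Finset.sum_add_distrib, Finset.sum_sub_distrib,
    ← Finset.mul_sum] at hblock
  have hR : ∑ k ∈ s, ricci n p Hm c (e k) = (n - q) * ((n - 1) * c) +
      ((∑ α, (Hm α).trace * ∑ k ∈ s, (Hm α *ᵥ e k) ⬝ᵥ e k)
        - ∑ α, ∑ k ∈ s, (Hm α *ᵥ e k) ⬝ᵥ (Hm α *ᵥ e k)) := by
    simp only [ricci, Finset.sum_add_distrib, Finset.sum_const, nsmul_eq_mul, hmc]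
    rw [Finset.sum_comm]
    simp only [Finset.sum_sub_distrib, Finset.mul_sum]
  have hG : ∑ k ∈ s, ∑ i ∈ sᶜ, (2 * sffInner n p Hm (e i) (e k) (e i) (e k)
      - sffInner n p Hm (e i) (e i) (e k) (e k)) =
      ∑ α, ∑ k ∈ s, ∑ i ∈ sᶜ, (2 * (((Hm α *ᵥ e i) ⬝ᵥ e k) * ((Hm α *ᵥ e i) ⬝ᵥ e k))
        - ((Hm α *ᵥ e i) ⬝ᵥ e i) * ((Hm α *ᵥ e k) ⬝ᵥ e k)) := by
    rw [Finset.sum_comm (s := Finset.univ)]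
    refine Finset.sum_congr rfl fun k _ => ?_
    rw [Finset.sum_comm (s := Finset.univ)]
    refine Finset.sum_congr rfl fun i _ => ?_
    simp only [sffInner, sff, Finset.mul_sum, Finset.sum_sub_distrib]
  simp only [Finset.sum_sub_distrib, ← Finset.mul_sum] at hG
  simp only [Finset.sum_sub_distrib, ← Finset.mul_sum]
  rw [hG]
  rw [hR, scalarCurv, sqNormSff, hH] at hpinch
  have hpos : (0 : ℝ) < q + (n - q) - 2 := by linarith
  refine lt_of_mul_lt_mul_left (lt_of_le_of_lt hblock ?_) hpos.le
  have hH' : (n : ℝ) ^ 2 * (n - q - 1) * (q - 1) * (c + meanCurvSq n p Hm) =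
      (n - q - 1) * (q - 1) * (n ^ 2 * c + ∑ α, (Hm α).trace ^ 2) := by
    rw [← hH]
    ring
  rw [hH'] at hpinch
  linarith
end
end

section
/- Let n ≥ 4, p ≥ 1, let H_1,…,H_p be real symmetric n×n matrices and c ≥ 0 a real number. Set σ_n = sgn(n−4)·((−1)ⁿ+3), where sgn is the standard sign function. Assume R > n(n−2)(c+H²) and that for every pair of orthonormal unit vectors u, v ∈ ℝⁿ one has Ric(u) + Ric(v) ≥ 2(n−2−2σ_n/(2n−σ_n))(c+H²). Then Ric(u) > 0 for every unit vector u ∈ ℝⁿ. -/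
open Matrix BigOperators

noncomputable section

theorem exists_orthonormal_rows_extending {n : ℕ} (i₀ : Fin n) {u : Fin n → ℝ} (hu : u ⬝ᵥ u = 1) :
    ∃ e : Fin n → Fin n → ℝ, e i₀ = u ∧ ∀ i j, e i ⬝ᵥ e j = if i = j then 1 else 0 := by
  have horth : Orthonormal ℝ (({i₀} : Set (Fin n)).domRestrict
      fun _ : Fin n => (WithLp.toLp 2 u : EuclideanSpace ℝ (Fin n))) := by
    rw [orthonormal_iff_ite]
    rintro ⟨i, hi⟩ ⟨j, hj⟩
    obtain rfl : i = i₀ := hi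
    obtain rfl : j = i := hj
    change inner ℝ (WithLp.toLp 2 u : EuclideanSpace ℝ (Fin n)) (WithLp.toLp 2 u) = _
    simp only [EuclideanSpace.inner_eq_star_dotProduct, star_trivial, hu, if_true]
  obtain ⟨b, hb⟩ := horth.exists_orthonormalBasis_extension_of_card_eq (by simp)
  refine ⟨fun i => (b i).ofLp, ?_, fun i j => ?_⟩
  · simp [hb i₀ rfl]
  · have h := orthonormal_iff_ite.mp b.orthonormal i j
    rw [EuclideanSpace.inner_eq_star_dotProduct] at h
    simpa [dotProduct_comm] using h

theorem sum_mulVec_dotProduct_eq_trace {n : ℕ} (M : Matrix (Fin n) (Fin n) ℝ)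
    {e : Fin n → Fin n → ℝ} (he : ∀ i j, e i ⬝ᵥ e j = if i = j then 1 else 0) :
    ∑ i, (M *ᵥ e i) ⬝ᵥ e i = M.trace := by
  have hP : Matrix.of e * (Matrix.of e)ᵀ = 1 := by
    ext i j
    simpa [Matrix.mul_apply, dotProduct, Matrix.one_apply] using he i j
  calc ∑ i, (M *ᵥ e i) ⬝ᵥ e i = (Matrix.of e * (M * (Matrix.of e)ᵀ)).trace := by
        simp only [Matrix.trace, Matrix.diag, Matrix.mul_apply, Matrix.mulVec, dotProduct,
          Matrix.transpose_apply, Matrix.of_apply]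
        exact Finset.sum_congr rfl fun i _ => Finset.sum_congr rfl fun j _ => mul_comm _ _
    _ = M.trace := by
        rw [Matrix.trace_mul_comm, Matrix.mul_assoc, mul_eq_one_comm.mp hP, Matrix.mul_one]

theorem sum_mulVec_dotProduct_self {n : ℕ} (M : Matrix (Fin n) (Fin n) ℝ)
    {e : Fin n → Fin n → ℝ} (he : ∀ i j, e i ⬝ᵥ e j = if i = j then 1 else 0) :
    ∑ i, (M *ᵥ e i) ⬝ᵥ (M *ᵥ e i) = ∑ i, ∑ j, M i j ^ 2 := by
  calc ∑ i, (M *ᵥ e i) ⬝ᵥ (M *ᵥ e i) = ∑ i, ((Mᵀ * M) *ᵥ e i) ⬝ᵥ e i := by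
        refine Finset.sum_congr rfl fun i _ => ?_
        rw [← Matrix.mulVec_mulVec, Matrix.dotProduct_mulVec, Matrix.mulVec_transpose]
    _ = (Mᵀ * M).trace := sum_mulVec_dotProduct_eq_trace _ he
    _ = ∑ i, ∑ j, M i j ^ 2 := by
        rw [Finset.sum_comm]
        simp [Matrix.trace, Matrix.mul_apply, sq]

theorem sq_mul_meanCurvSq {n : ℕ} (hn : n ≠ 0) (p : ℕ) (Hm : Fin p → Matrix (Fin n) (Fin n) ℝ) :
    (n : ℝ) ^ 2 * meanCurvSq n p Hm = ∑ α, (Hm α).trace ^ 2 := by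
  have hn' : (n : ℝ) ≠ 0 := Nat.cast_ne_zero.mpr hn
  rw [meanCurvSq, Finset.mul_sum]
  refine Finset.sum_congr rfl fun α _ => ?_
  field_simp

/-- The scalar curvature is the trace of the Ricci curvature. -/
theorem sum_ricci_eq_scalarCurv {n : ℕ} (hn : n ≠ 0) (p : ℕ)
    (Hm : Fin p → Matrix (Fin n) (Fin n) ℝ) (c : ℝ) {e : Fin n → Fin n → ℝ}
    (he : ∀ i j, e i ⬝ᵥ e j = if i = j then 1 else 0) :
    ∑ i, ricci n p Hm c (e i) = scalarCurv n p Hm c := by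
  simp only [ricci, scalarCurv, sqNormSff, sq_mul_meanCurvSq hn]
  rw [Finset.sum_add_distrib, Finset.sum_comm, add_sub_assoc, ← Finset.sum_sub_distrib]
  congr 1
  · simp [mul_assoc]
  · refine Finset.sum_congr rfl fun α _ => ?_
    rw [Finset.sum_sub_distrib, ← Finset.mul_sum, sum_mulVec_dotProduct_eq_trace _ he,
      sum_mulVec_dotProduct_self _ he, sq]

/-- The squared norm of the second fundamental form splits into its traceless and trace parts. -/
theorem sqNormSff_sub_meanCurvSq {n : ℕ} (hn : n ≠ 0) (p : ℕ)
    (Hm : Fin p → Matrix (Fin n) (Fin n) ℝ) :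
    sqNormSff n p Hm - n * meanCurvSq n p Hm =
      ∑ α, ∑ i, ∑ j, (Hm α - ((Hm α).trace / n) • (1 : Matrix (Fin n) (Fin n) ℝ)) i j ^ 2 := by
  have hn' : (n : ℝ) ≠ 0 := Nat.cast_ne_zero.mpr hn
  rw [sqNormSff, meanCurvSq, Finset.mul_sum, ← Finset.sum_sub_distrib]
  refine Finset.sum_congr rfl fun α _ => ?_
  obtain ⟨t, ht⟩ : ∃ t, t = (Hm α).trace / n := ⟨_, rfl⟩
  have htr : ∑ i, Hm α i i = n * t := by
    rw [ht, mul_div_cancel₀ _ hn']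
    rfl
  rw [← ht]
  have hrow : ∀ i, ∑ j, (Hm α - t • (1 : Matrix (Fin n) (Fin n) ℝ)) i j ^ 2
      = ∑ j, Hm α i j ^ 2 - 2 * t * Hm α i i + t ^ 2 := fun i => by
    simp [Matrix.one_apply, sub_sq, Finset.sum_add_distrib, Finset.sum_sub_distrib]
    ring
  simp only [hrow, Finset.sum_add_distrib, Finset.sum_sub_distrib, ← Finset.mul_sum, htr]
  simp
  ring

/-- The Ricci curvature at a totally umbilical point. -/
theorem ricci_of_umbilical {n : ℕ} (hn : n ≠ 0) (p : ℕ) (Hm : Fin p → Matrix (Fin n) (Fin n) ℝ)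
    (c : ℝ) (hH : ∀ α, Hm α = ((Hm α).trace / n) • (1 : Matrix (Fin n) (Fin n) ℝ))
    {u : Fin n → ℝ} (hu : u ⬝ᵥ u = 1) :
    ricci n p Hm c u = (n - 1) * (c + meanCurvSq n p Hm) := by
  have hn' : (n : ℝ) ≠ 0 := Nat.cast_ne_zero.mpr hn
  rw [ricci, meanCurvSq, mul_add, Finset.mul_sum]
  congr 1
  refine Finset.sum_congr rfl fun α _ => ?_
  have hmul : Hm α *ᵥ u = ((Hm α).trace / n) • u := by
    conv_lhs => rw [hH α]
    rw [Matrix.smul_mulVec, Matrix.one_mulVec]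
  rw [hmul]
  simp only [smul_dotProduct, dotProduct_smul, hu, smul_eq_mul]
  field_simp

theorem le_pinching_constant {n : ℕ} (hn : 4 ≤ n) :
    (n : ℝ) ≤ 2 * ((n : ℝ) - 2 - 2 * (Real.sign ((n : ℝ) - 4) * ((-1 : ℝ) ^ n + 3)) /
      (2 * (n : ℝ) - Real.sign ((n : ℝ) - 4) * ((-1 : ℝ) ^ n + 3))) := by
  obtain rfl | hn4 := hn.eq_or_lt
  · norm_num
  have h4 : (0 : ℝ) < (n : ℝ) - 4 := sub_pos.mpr (by exact_mod_cast hn4)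
  rw [Real.sign_of_pos h4, one_mul]
  obtain rfl | hn5 := (Nat.succ_le_of_lt hn4).eq_or_lt
  · norm_num
  have h6 : (6 : ℝ) ≤ n := by exact_mod_cast hn5
  have hpow : (-1 : ℝ) ^ n ≤ 1 := by
    rcases neg_one_pow_eq_or ℝ n with h | h <;> norm_num [h]
  have hdiv : 2 * ((-1 : ℝ) ^ n + 3) / (2 * (n : ℝ) - ((-1 : ℝ) ^ n + 3)) ≤ 1 := by
    rw [div_le_one (by linarith)]
    linarith
  linarith

theorem stmt_12 (n p : ℕ) (hn : 4 ≤ n) (hp : 1 ≤ p)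
    (Hm : Fin p → Matrix (Fin n) (Fin n) ℝ) (hsym : ∀ α, (Hm α).IsSymm)
    (c : ℝ) (hc : 0 ≤ c)
    (hR : scalarCurv n p Hm c > (n : ℝ) * ((n : ℝ) - 2) * (c + meanCurvSq n p Hm))
    (hRic : ∀ u v : Fin n → ℝ, u ⬝ᵥ u = 1 → v ⬝ᵥ v = 1 → u ⬝ᵥ v = 0 →
      ricci n p Hm c u + ricci n p Hm c v ≥
        2 * ((n : ℝ) - 2 - 2 * (Real.sign ((n : ℝ) - 4) * ((-1 : ℝ) ^ n + 3)) / (2 * (n : ℝ) - Real.sign ((n : ℝ) - 4) * ((-1 : ℝ) ^ n + 3)))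
          * (c + meanCurvSq n p Hm)) :
    ∀ u : Fin n → ℝ, u ⬝ᵥ u = 1 → 0 < ricci n p Hm c u := by
  intro u hu
  have hn0 : n ≠ 0 := by omega
  have hn4 : (4 : ℝ) ≤ n := by exact_mod_cast hn
  have hdecomp := sqNormSff_sub_meanCurvSq hn0 p Hm
  have hρ : 0 ≤ sqNormSff n p Hm - n * meanCurvSq n p Hm := by
    rw [hdecomp]
    positivity
  have hscal : scalarCurv n p Hm c = n * (n - 1) * (c + meanCurvSq n p Hm)
      - (sqNormSff n p Hm - n * meanCurvSq n p Hm) := by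
    rw [scalarCurv]
    ring
  have hK : 0 < c + meanCurvSq n p Hm := by
    have : 0 < (n : ℝ) * (c + meanCurvSq n p Hm) := by linarith
    exact pos_of_mul_pos_right this (by linarith)
  obtain ⟨e, rfl, he⟩ := exists_orthonormal_rows_extending (⟨0, by omega⟩ : Fin n) hu
  set i₀ : Fin n := ⟨0, by omega⟩
  have hpair : ∀ i ∈ Finset.univ.erase i₀, n * (c + meanCurvSq n p Hm)
      - ricci n p Hm c (e i₀) ≤ ricci n p Hm c (e i) := fun i hi => by
    have h := hRic (e i₀) (e i) hu (by simp [he])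
      (by simp [he, (Finset.ne_of_mem_erase hi).symm])
    have := mul_le_mul_of_nonneg_right (le_pinching_constant hn) hK.le
    linarith
  have hsum := Finset.card_nsmul_le_sum _ _ _ hpair
  have htrace := sum_ricci_eq_scalarCurv hn0 p Hm c he
  rw [← Finset.add_sum_erase _ _ (Finset.mem_univ i₀)] at htrace
  rw [Finset.card_erase_of_mem (Finset.mem_univ _), Finset.card_univ, Fintype.card_fin, nsmul_eq_mul,
    Nat.cast_sub (by omega), Nat.cast_one] at hsum
  have hlower : sqNormSff n p Hm - n * meanCurvSq n p Hm
      ≤ ((n : ℝ) - 2) * ricci n p Hm c (e i₀) := by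
    linarith
  rcases hρ.eq_or_lt with hzero | hpos
  · rw [ricci_of_umbilical hn0 p Hm c _ hu]
    · exact mul_pos (by linarith) hK
    · intro α
      rw [hdecomp, eq_comm, Finset.sum_eq_zero_iff_of_nonneg fun _ _ => by positivity] at hzero
      have hα := hzero α (Finset.mem_univ α)
      rw [Finset.sum_eq_zero_iff_of_nonneg fun _ _ => by positivity] at hα
      refine sub_eq_zero.mp (Matrix.ext fun i j => ?_)
      have hi := hα i (Finset.mem_univ i)
      rw [Finset.sum_eq_zero_iff_of_nonneg fun _ _ => by positivity] at hi
      exact pow_eq_zero_iff two_ne_zero |>.mp (hi j (Finset.mem_univ j))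
  · exact pos_of_mul_pos_right (hpos.trans_le hlower) (by linarith)
end
end

section
/- Let n ≥ 4, p ≥ 1, let H_1,…,H_p be real symmetric n×n matrices and c ≥ 0 a real number. Set τ_n = (−1)ⁿ+3. Assume R > n(n−2)(c+H²) and Ric(u) ≤ (n−2+2τ_n/(2n+τ_n))(c+H²) for every unit vector u ∈ ℝⁿ. Then Ric(u) > 0 for every unit vector u ∈ ℝⁿ. -/
open Matrix BigOperators

noncomputable section

open scoped MatrixOrder in
/-- The quadratic form of a positive semidefinite matrix is bounded on unit vectors by the trace. -/
lemma dotProduct_mulVec_le_trace {n : ℕ} {A : Matrix (Fin n) (Fin n) ℝ} (hA : A.PosSemidef)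
    {u : Fin n → ℝ} (hu : u ⬝ᵥ u = 1) : u ⬝ᵥ A *ᵥ u ≤ A.trace := by
  obtain ⟨B, rfl⟩ := CStarAlgebra.nonneg_iff_eq_star_mul_self.mp hA.nonneg
  rw [star_eq_conjTranspose]
  have hquad : u ⬝ᵥ (Bᴴ * B) *ᵥ u = ∑ k, (∑ i, B k i * u i) ^ 2 := by
    rw [conjTranspose_eq_transpose_of_trivial, ← mulVec_mulVec, dotProduct_mulVec,
      vecMul_transpose]
    simp [dotProduct, mulVec, sq]
  have htr : (Bᴴ * B).trace = ∑ k, ∑ i, B k i ^ 2 := by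
    rw [trace_mul_comm]
    simp [trace, mul_apply, sq]
  rw [hquad, htr]
  refine Finset.sum_le_sum fun k _ => ?_
  have hu' : ∑ i, u i ^ 2 = 1 := by simpa [dotProduct, sq] using hu
  simpa [hu'] using Finset.sum_mul_sq_le_sq_mul_sq Finset.univ (B k) u

/-- The Ricci tensor as a matrix, whose quadratic form on unit vectors is `ricci`. -/
def ricciMatrix (n p : ℕ) (Hm : Fin p → Matrix (Fin n) (Fin n) ℝ) (c : ℝ) :
    Matrix (Fin n) (Fin n) ℝ :=
  (((n : ℝ) - 1) * c) • 1 + ∑ α, ((Hm α).trace • Hm α - Hm α * Hm α)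

lemma ricciMatrix_isSymm {n p : ℕ} {Hm : Fin p → Matrix (Fin n) (Fin n) ℝ}
    (hsym : ∀ α, (Hm α).IsSymm) (c : ℝ) : (ricciMatrix n p Hm c).IsSymm := by
  simp [Matrix.IsSymm, ricciMatrix, transpose_sum, fun α => (hsym α).eq]

lemma dotProduct_ricciMatrix_mulVec {n p : ℕ} {Hm : Fin p → Matrix (Fin n) (Fin n) ℝ}
    (hsym : ∀ α, (Hm α).IsSymm) (c : ℝ) {u : Fin n → ℝ} (hu : u ⬝ᵥ u = 1) :
    u ⬝ᵥ ricciMatrix n p Hm c *ᵥ u = ricci n p Hm c u := by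
  have hsq (α : Fin p) : u ⬝ᵥ (Hm α * Hm α) *ᵥ u = (Hm α *ᵥ u) ⬝ᵥ (Hm α *ᵥ u) := by
    rw [← mulVec_mulVec, dotProduct_mulVec, ← mulVec_transpose, (hsym α).eq]
  simp only [ricciMatrix, ricci, add_mulVec, sum_mulVec, sub_mulVec, smul_mulVec, one_mulVec,
    dotProduct_add, dotProduct_sum, dotProduct_sub, dotProduct_smul, hsq, hu, smul_eq_mul, mul_one]
  simp only [dotProduct_comm u]

lemma trace_ricciMatrix {n p : ℕ} (hn : n ≠ 0) {Hm : Fin p → Matrix (Fin n) (Fin n) ℝ}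
    (hsym : ∀ α, (Hm α).IsSymm) (c : ℝ) :
    (ricciMatrix n p Hm c).trace = scalarCurv n p Hm c := by
  have hsq (α : Fin p) : (Hm α * Hm α).trace = ∑ i, ∑ j, Hm α i j ^ 2 := by
    simp only [trace, diag_apply, mul_apply, sq]
    exact Finset.sum_congr rfl fun i _ => Finset.sum_congr rfl fun j _ => by
      rw [(hsym α).apply i j]
  have hH : (n : ℝ) ^ 2 * meanCurvSq n p Hm = ∑ α, (Hm α).trace ^ 2 := by
    rw [meanCurvSq, Finset.mul_sum]
    exact Finset.sum_congr rfl fun α _ => by field_simp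
  rw [scalarCurv, hH, sqNormSff, ricciMatrix]
  simp only [trace_add, trace_sum, trace_sub, trace_smul, trace_one, hsq, smul_eq_mul,
    Finset.sum_sub_distrib, Fintype.card_fin, ← pow_two (Matrix.trace _)]
  ring

/-- An upper bound of a quadratic form on unit vectors bounds the matrix. -/
lemma posSemidef_smul_one_sub {n : ℕ} {M : Matrix (Fin n) (Fin n) ℝ} (hM : M.IsSymm) {b : ℝ}
    (hb : ∀ u : Fin n → ℝ, u ⬝ᵥ u = 1 → u ⬝ᵥ M *ᵥ u ≤ b) : (b • 1 - M).PosSemidef := by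
  refine PosSemidef.of_dotProduct_mulVec_nonneg ?_ fun x => ?_
  · rw [IsHermitian, conjTranspose_eq_transpose_of_trivial]
    simp [hM.eq]
  · rcases eq_or_ne x 0 with rfl | hx
    · simp
    have hpos : 0 < x ⬝ᵥ x := by simpa using dotProduct_star_self_pos_iff.mpr hx
    have hs : √(x ⬝ᵥ x) ^ 2 = x ⬝ᵥ x := Real.sq_sqrt hpos.le
    have h0 : √(x ⬝ᵥ x) ≠ 0 := (Real.sqrt_pos.mpr hpos).ne'
    have h := hb ((√(x ⬝ᵥ x))⁻¹ • x) (by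
      simp only [smul_dotProduct, dotProduct_smul, smul_eq_mul]
      field_simp
      exact hs.symm)
    simp only [mulVec_smul, smul_dotProduct, dotProduct_smul, smul_eq_mul, ← mul_assoc, ← sq,
      inv_pow, hs] at h
    rw [inv_mul_le_iff₀ hpos] at h
    simp only [star_trivial, sub_mulVec, smul_mulVec, one_mulVec, dotProduct_sub, dotProduct_smul,
      smul_eq_mul]
    linarith

/-- The pinching constant is small enough for the trace argument. -/
lemma sub_one_mul_pinching_le {n : ℕ} (hn : 4 ≤ n) :
    ((n : ℝ) - 1) * (2 * ((-1 : ℝ) ^ n + 3) / (2 * (n : ℝ) + ((-1 : ℝ) ^ n + 3))) ≤ n - 2 := by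
  have hn' : (4 : ℝ) ≤ n := by exact_mod_cast hn
  rcases neg_one_pow_eq_or ℝ n with h | h <;> rw [h, ← mul_div_assoc, div_le_iff₀ (by linarith)] <;>
    nlinarith

theorem stmt_17 (n p : ℕ) (hn : 4 ≤ n) (hp : 1 ≤ p)
    (Hm : Fin p → Matrix (Fin n) (Fin n) ℝ) (hsym : ∀ α, (Hm α).IsSymm)
    (c : ℝ) (hc : 0 ≤ c)
    (hR : scalarCurv n p Hm c > (n : ℝ) * ((n : ℝ) - 2) * (c + meanCurvSq n p Hm))
    (hRic : ∀ u : Fin n → ℝ, u ⬝ᵥ u = 1 →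
      ricci n p Hm c u ≤
        ((n : ℝ) - 2 + 2 * ((-1 : ℝ) ^ n + 3) / (2 * (n : ℝ) + ((-1 : ℝ) ^ n + 3)))
          * (c + meanCurvSq n p Hm)) :
    ∀ u : Fin n → ℝ, u ⬝ᵥ u = 1 → 0 < ricci n p Hm c u := by
  intro u hu
  have hn' : (4 : ℝ) ≤ n := by exact_mod_cast hn
  set K := c + meanCurvSq n p Hm
  set δ := 2 * ((-1 : ℝ) ^ n + 3) / (2 * (n : ℝ) + ((-1 : ℝ) ^ n + 3))
  have hK : 0 ≤ K := add_nonneg hc (Finset.sum_nonneg fun α _ => sq_nonneg _)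
  have hδ : ((n : ℝ) - 1) * δ * K ≤ (n - 2) * K :=
    mul_le_mul_of_nonneg_right (sub_one_mul_pinching_le hn) hK
  have hpsd : ((((n : ℝ) - 2 + δ) * K) • 1 - ricciMatrix n p Hm c).PosSemidef :=
    posSemidef_smul_one_sub (ricciMatrix_isSymm hsym c) fun v hv =>
      (dotProduct_ricciMatrix_mulVec hsym c hv).trans_le (hRic v hv)
  have h := dotProduct_mulVec_le_trace hpsd hu
  simp only [sub_mulVec, smul_mulVec, one_mulVec, dotProduct_sub, dotProduct_smul, hu,
    dotProduct_ricciMatrix_mulVec hsym c hu, trace_sub, trace_smul, trace_one,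
    trace_ricciMatrix (by lia) hsym, smul_eq_mul, Fintype.card_fin] at h
  nlinarith
end
end
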